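/- arXiv:1304.4813 — 2 statements merged into one kernel-verified Lean document; each statement's English description precedes it below -/
import Mathlib

section
/- For all integers n ≥ k ≥ 1 one has the identity (in ℚ): S′_{n,k}(1) = (n(k−1)/2 − k(k−1)/4)·S_{n,k} + ((n+1−k)/2)·S_{n,k−1}, where S′_{n,k} denotes the formal derivative of the q-Stirling polynomial S_{n,k}(q). Consequently, the average value over Π_n^k of any set-partition statistic whose generating polynomial on Π_n^k is S_{n,k}(q) equals n(k−1)/2 − (1/2)·C(k,2) + ((n+1−k)/2)·S_{n,k−1}/S_{n,k}. -/
open scoped Classical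

def seg (n : ℕ) : Finset ℕ := Finset.Icc 1 n

def IsPartition (P : Finset (Finset ℕ)) (S : Finset ℕ) : Prop :=
  ∅ ∉ P ∧ (∀ B ∈ P, ∀ C ∈ P, B ≠ C → Disjoint B C) ∧ P.biUnion id = S

noncomputable def partitions (n : ℕ) : Finset (Finset (Finset ℕ)) :=
  ((seg n).powerset.powerset).filter fun P => IsPartition P (seg n)

noncomputable def partitionsK (n k : ℕ) : Finset (Finset (Finset ℕ)) :=
  (partitions n).filter fun P => P.card = k

noncomputable def bell (n : ℕ) : ℕ := (partitions n).card

noncomputable def stirling (n k : ℕ) : ℕ := (partitionsK n k).card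

/-- `(i, j)` is an edge of the set partition `P`. -/
def IsEdge (P : Finset (Finset ℕ)) (i j : ℕ) : Prop :=
  i < j ∧ ∃ B ∈ P, i ∈ B ∧ j ∈ B ∧ ∀ p ∈ B, ¬(i < p ∧ p < j)

/-- `crol P`: number of linear crossings. -/
noncomputable def crol (P : Finset (Finset ℕ)) : ℕ :=
  Nat.card {e : (ℕ × ℕ) × ℕ × ℕ //
    IsEdge P e.1.1 e.1.2 ∧ IsEdge P e.2.1 e.2.2 ∧
      e.1.1 < e.2.1 ∧ e.2.1 < e.1.2 ∧ e.1.2 < e.2.2}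

/-- `(i, j)` is a circular edge of `P`. -/
def IsCircEdge (P : Finset (Finset ℕ)) (i j : ℕ) : Prop :=
  IsEdge P i j ∨
    ∃ B ∈ P, ∃ h : B.Nonempty, 2 ≤ B.card ∧ i = B.min' h ∧ j = B.max' h

/-- `croc P`: number of circular crossings. -/
noncomputable def croc (P : Finset (Finset ℕ)) : ℕ :=
  Nat.card {e : (ℕ × ℕ) × ℕ × ℕ //
    IsCircEdge P e.1.1 e.1.2 ∧ IsCircEdge P e.2.1 e.2.2 ∧
      e.1.1 < e.2.1 ∧ e.2.1 < e.1.2 ∧ e.1.2 < e.2.2}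

/-- Two blocks overlap: `min B < min B' < max B < max B'`. -/
def Overlap (B B' : Finset ℕ) : Prop :=
  ∃ (h : B.Nonempty) (h' : B'.Nonempty),
    B.min' h < B'.min' h' ∧ B'.min' h' < B.max' h ∧ B.max' h < B'.max' h'

/-- `ov P`: number of (unordered) pairs of blocks of `P` that overlap. -/
noncomputable def ov (P : Finset (Finset ℕ)) : ℕ :=
  Nat.card {p : Finset ℕ × Finset ℕ // p.1 ∈ P ∧ p.2 ∈ P ∧ Overlap p.1 p.2}

/-- Two blocks embrace: `min B < min B' ≤ max B' < max B`. -/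
def Embrace (B B' : Finset ℕ) : Prop :=
  ∃ (h : B.Nonempty) (h' : B'.Nonempty),
    B.min' h < B'.min' h' ∧ B'.min' h' ≤ B'.max' h' ∧ B'.max' h' < B.max' h

noncomputable def emb (P : Finset (Finset ℕ)) : ℕ :=
  Nat.card {p : Finset ℕ × Finset ℕ // p.1 ∈ P ∧ p.2 ∈ P ∧ Embrace p.1 p.2}

/-- The block of `P` containing `i`. -/
noncomputable def blockOf (P : Finset (Finset ℕ)) (i : ℕ) : Finset ℕ :=
  (P.filter fun B => i ∈ B).biUnion id

/-- The restricted growth function of `P`: `rgf P i = j` iff `i` lies in the `j`-th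
block of `P`, the blocks being ordered by increasing minima. -/
noncomputable def rgf (P : Finset (Finset ℕ)) (i : ℕ) : ℕ :=
  (P.filter fun B => B.min ≤ (blockOf P i).min).card

/-- A 2-pattern: a word on `{1,2}` containing both letters. -/
def TwoPattern {r : ℕ} (σ : Fin r → ℕ) : Prop :=
  (∀ t, σ t = 1 ∨ σ t = 2) ∧ (∃ t, σ t = 1) ∧ (∃ t, σ t = 2)

/-- `occ n σ P`: number of occurrences of the 2-pattern `σ` in the partition `P` of `[n]`. -/
noncomputable def occ (n : ℕ) {r : ℕ} (σ : Fin r → ℕ) (P : Finset (Finset ℕ)) : ℕ :=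
  Nat.card {i : Fin r → ℕ // StrictMono i ∧ (∀ t, i t ∈ seg n) ∧
    ∃ a b : ℕ, a < b ∧
      ∀ t, (σ t = 1 → rgf P (i t) = a) ∧ (σ t = 2 → rgf P (i t) = b)}

/-- Carlitz `q`-Stirling polynomials. -/
noncomputable def qS : ℕ → ℕ → Polynomial ℚ
  | 0, 0 => 1
  | 0, _ + 1 => 0
  | _ + 1, 0 => 0
  | n + 1, k + 1 =>
      Polynomial.X ^ k * qS n k +
        (∑ i ∈ Finset.range (k + 1), Polynomial.X ^ i) * qS n (k + 1)

/-- Standardization: the order preserving bijection `S → [|S|]`. -/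
def stdMap (S : Finset ℕ) (a : ℕ) : ℕ := (S.filter fun x => x ≤ a).card

/-- The standardized 2-block partition obtained from two blocks `A, B`. -/
def stdPair (A B : Finset ℕ) : Finset (Finset ℕ) :=
  {A.image (stdMap (A ∪ B)), B.image (stdMap (A ∪ B))}

theorem isPartition_iff {P : Finset (Finset ℕ)} {S : Finset ℕ} :
    IsPartition P S ↔ (∀ B ∈ P, B.Nonempty) ∧
      (∀ x, ∀ B ∈ P, ∀ C ∈ P, x ∈ B → x ∈ C → B = C) ∧ ∀ x, x ∈ S ↔ ∃ B ∈ P, x ∈ B := by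
  refine and_congr ?_ (and_congr ?_ ?_)
  · simp only [Finset.nonempty_iff_ne_empty]
    exact ⟨fun h B hB h' => h (h' ▸ hB), fun h h' => h _ h' rfl⟩
  · simp only [Finset.disjoint_left]
    exact ⟨fun h x B hB C hC hxB hxC => by_contra fun hne => h B hB C hC hne hxB hxC,
      fun h B hB C hC hne x hxB hxC => hne (h x B hB C hC hxB hxC)⟩
  · simp only [Finset.ext_iff, Finset.mem_biUnion, id_eq]
    exact forall_congr' fun _ => Iff.comm

theorem IsPartition.subset {P : Finset (Finset ℕ)} {S B : Finset ℕ}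
    (h : IsPartition P S) (hB : B ∈ P) : B ⊆ S := fun x hx =>
  ((isPartition_iff.1 h).2.2 x).2 ⟨B, hB, hx⟩

theorem IsPartition.erase_block {P : Finset (Finset ℕ)} {S B : Finset ℕ}
    (h : IsPartition P S) (hB : B ∈ P) : IsPartition (P.erase B) (S \ B) := by
  rw [isPartition_iff] at h ⊢
  obtain ⟨h1, h2, h3⟩ := h
  refine ⟨by grind, by grind, fun x => ?_⟩
  rw [Finset.mem_sdiff, h3]
  constructor <;> grind

theorem IsPartition.insert_block {P : Finset (Finset ℕ)} {S B : Finset ℕ}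
    (h : IsPartition P (S \ B)) (hB : B.Nonempty) (hBS : B ⊆ S) :
    IsPartition (insert B P) S := by
  rw [isPartition_iff] at h ⊢
  obtain ⟨h1, h2, h3⟩ := h
  have h4 : ∀ C ∈ P, ∀ x ∈ C, x ∉ B := fun C hC x hx =>
    (Finset.mem_sdiff.1 ((h3 x).2 ⟨C, hC, hx⟩)).2
  refine ⟨by grind, by grind, fun x => ?_⟩
  have := h3 x
  rw [Finset.mem_sdiff] at this
  by_cases hx : x ∈ B
  · exact ⟨fun _ => ⟨B, Finset.mem_insert_self _ _, hx⟩, fun _ => hBS hx⟩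
  · grind

theorem IsPartition.notMem_of_sdiff {P : Finset (Finset ℕ)} {S B : Finset ℕ}
    (h : IsPartition P (S \ B)) (hB : B.Nonempty) : B ∉ P := fun hBP => by
  obtain ⟨x, hx⟩ := hB
  exact (Finset.mem_sdiff.1 (h.subset hBP hx)).2 hx

theorem IsPartition.blockOf_eq {P : Finset (Finset ℕ)} {S B : Finset ℕ} {a : ℕ}
    (h : IsPartition P S) (hB : B ∈ P) (ha : a ∈ B) : blockOf P a = B := by
  have : P.filter (fun C => a ∈ C) = {B} := by
    ext C
    rw [Finset.mem_filter, Finset.mem_singleton]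
    constructor
    · rintro ⟨hC, haC⟩
      exact (isPartition_iff.1 h).2.1 a C hC B hB haC ha
    · rintro rfl
      exact ⟨hB, ha⟩
  rw [blockOf, this, Finset.singleton_biUnion, id_eq]

theorem IsPartition.blockOf_mem {P : Finset (Finset ℕ)} {S : Finset ℕ} {a : ℕ}
    (h : IsPartition P S) (ha : a ∈ S) : blockOf P a ∈ P ∧ a ∈ blockOf P a := by
  obtain ⟨B, hB, haB⟩ := ((isPartition_iff.1 h).2.2 a).1 ha
  rw [h.blockOf_eq hB haB]
  exact ⟨hB, haB⟩

theorem mem_partitionsK {n k : ℕ} {P : Finset (Finset ℕ)} :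
    P ∈ partitionsK n k ↔ IsPartition P (seg n) ∧ P.card = k := by
  simp only [partitionsK, partitions, Finset.mem_filter, Finset.mem_powerset]
  refine and_congr_left fun _ => and_iff_right_of_imp fun h B hB => ?_
  exact Finset.mem_powerset.2 (h.subset hB)

theorem seg_succ (n : ℕ) : seg (n + 1) = insert (n + 1) (seg n) := by
  ext x
  simp only [seg, Finset.mem_Icc, Finset.mem_insert]
  omega

theorem succ_notMem_seg (n : ℕ) : n + 1 ∉ seg n := by
  simp [seg]

theorem card_partitionsK_singleton_mem (n k : ℕ) :
    ((partitionsK (n + 1) (k + 1)).filter fun P => {n + 1} ∈ P).card = stirling n k := by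
  have hseg : seg (n + 1) \ {n + 1} = seg n := by
    rw [seg_succ, ← Finset.erase_eq, Finset.erase_insert (succ_notMem_seg n)]
  symm
  refine Finset.card_nbij' (fun P => insert {n + 1} P) (fun P => P.erase {n + 1}) ?_ ?_ ?_ ?_
  · intro P hP
    obtain ⟨hP, hc⟩ := mem_partitionsK.1 hP
    rw [← hseg] at hP
    refine Finset.mem_coe.2 (Finset.mem_filter.2 ⟨mem_partitionsK.2 ⟨?_, ?_⟩, ?_⟩)
    · exact hP.insert_block (Finset.singleton_nonempty _) (by simp [seg_succ])
    · rw [Finset.card_insert_of_notMem (hP.notMem_of_sdiff (Finset.singleton_nonempty _)), hc]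
    · exact Finset.mem_insert_self _ _
  · intro P hP
    obtain ⟨hP, hm⟩ := Finset.mem_filter.1 (Finset.mem_coe.1 hP)
    obtain ⟨hP, hc⟩ := mem_partitionsK.1 hP
    refine Finset.mem_coe.2 (mem_partitionsK.2 ⟨hseg ▸ hP.erase_block hm, ?_⟩)
    rw [Finset.card_erase_of_mem hm, hc, Nat.add_sub_cancel]
  · intro P hP
    have hP := (mem_partitionsK.1 hP).1
    rw [← hseg] at hP
    exact Finset.erase_insert (hP.notMem_of_sdiff (Finset.singleton_nonempty _))
  · intro P hP
    exact Finset.insert_erase (Finset.mem_filter.1 (Finset.mem_coe.1 hP)).2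

theorem card_partitionsK_singleton_notMem (n k : ℕ) :
    ((partitionsK (n + 1) k).filter fun P => {n + 1} ∉ P).card = k * stirling n k := by
  have hcard : ((partitionsK n k).sigma fun Q => Q).card = k * stirling n k := by
    rw [Finset.card_sigma, Finset.sum_congr rfl fun Q hQ => (mem_partitionsK.1 hQ).2,
      Finset.sum_const, smul_eq_mul, mul_comm, stirling]
  have hgrow : ∀ B ⊆ seg n, seg (n + 1) \ insert (n + 1) B = seg n \ B := by
    intro B _
    have := succ_notMem_seg n
    rw [seg_succ]
    grind
  rw [← hcard]
  symm
  refine Finset.card_nbij'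
    (fun q => insert (insert (n + 1) q.2) (q.1.erase q.2))
    (fun P => ⟨insert ((blockOf P (n + 1)).erase (n + 1)) (P.erase (blockOf P (n + 1))),
      (blockOf P (n + 1)).erase (n + 1)⟩) ?_ ?_ ?_ ?_
  · rintro ⟨Q, B⟩ hq
    obtain ⟨hQ, hB⟩ := Finset.mem_sigma.1 (Finset.mem_coe.1 hq)
    obtain ⟨hQ, hc⟩ := mem_partitionsK.1 hQ
    have hBS := hQ.subset hB
    have hE := hQ.erase_block hB
    have hBne := (isPartition_iff.1 hQ).1 B hB
    have ha : n + 1 ∉ B := fun h => succ_notMem_seg n (hBS h)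
    rw [← hgrow B hBS] at hE
    have hI := hE.insert_block (Finset.insert_nonempty _ _)
      (by rw [seg_succ]; exact Finset.insert_subset_insert _ hBS)
    refine Finset.mem_coe.2 (Finset.mem_filter.2 ⟨mem_partitionsK.2 ⟨hI, ?_⟩, fun hs => ?_⟩)
    · rw [Finset.card_insert_of_notMem (hE.notMem_of_sdiff (Finset.insert_nonempty _ _)),
        Finset.card_erase_add_one hB, hc]
    · have := (isPartition_iff.1 hI).2.1 (n + 1) _ hs _ (Finset.mem_insert_self _ _)
        (Finset.mem_singleton_self _) (Finset.mem_insert_self _ _)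
      obtain ⟨x, hx⟩ := hBne
      have hx' : x ∈ ({n + 1} : Finset ℕ) := this ▸ Finset.mem_insert_of_mem hx
      exact ha (Finset.mem_singleton.1 hx' ▸ hx)
  · intro P hP
    obtain ⟨hP, hs⟩ := Finset.mem_filter.1 (Finset.mem_coe.1 hP)
    obtain ⟨hP, hc⟩ := mem_partitionsK.1 hP
    obtain ⟨hC, ha⟩ := hP.blockOf_mem (a := n + 1) (by simp [seg_succ])
    dsimp only
    set C := blockOf P (n + 1)
    have hne : (C.erase (n + 1)).Nonempty := by
      rw [Finset.nonempty_iff_ne_empty, Ne, Finset.erase_eq_empty_iff]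
      rintro (h | h)
      · simp [h] at ha
      · exact hs (h ▸ hC)
    have hsub : C.erase (n + 1) ⊆ seg n := by
      rw [← Finset.subset_insert_iff, ← seg_succ]
      exact hP.subset hC
    have hE := hP.erase_block hC
    rw [← Finset.insert_erase ha, hgrow _ hsub, Finset.insert_erase ha] at hE
    refine Finset.mem_coe.2 (Finset.mem_sigma.2 ⟨mem_partitionsK.2 ⟨?_, ?_⟩, ?_⟩)
    · exact hE.insert_block hne hsub
    · rw [Finset.card_insert_of_notMem (hE.notMem_of_sdiff hne), Finset.card_erase_add_one hC, hc]
    · exact Finset.mem_insert_self _ _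
  · rintro ⟨Q, B⟩ hq
    obtain ⟨hQ, hB⟩ := Finset.mem_sigma.1 (Finset.mem_coe.1 hq)
    have hQ := (mem_partitionsK.1 hQ).1
    have hBS := hQ.subset hB
    have hE := hQ.erase_block hB
    have ha : n + 1 ∉ B := fun h => succ_notMem_seg n (hBS h)
    rw [← hgrow B hBS] at hE
    have hI := hE.insert_block (Finset.insert_nonempty _ _)
      (by rw [seg_succ]; exact Finset.insert_subset_insert _ hBS)
    have hb := hI.blockOf_eq (Finset.mem_insert_self _ _) (Finset.mem_insert_self _ _)
    dsimp only at hB ⊢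
    rw [hb, Finset.erase_insert ha,
      Finset.erase_insert (hE.notMem_of_sdiff (Finset.insert_nonempty _ _)),
      Finset.insert_erase hB]
  · intro P hP
    obtain ⟨hP, hs⟩ := Finset.mem_filter.1 (Finset.mem_coe.1 hP)
    have hP := (mem_partitionsK.1 hP).1
    obtain ⟨hC, ha⟩ := hP.blockOf_mem (a := n + 1) (by simp [seg_succ])
    dsimp only
    set C := blockOf P (n + 1)
    have hnm : C.erase (n + 1) ∉ P.erase C := fun h => by
      have hmem := Finset.mem_of_mem_erase h
      obtain ⟨x, hx⟩ := (isPartition_iff.1 hP).1 _ hmem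
      exact Finset.ne_of_mem_erase h
        ((isPartition_iff.1 hP).2.1 x _ hmem _ hC hx (Finset.mem_of_mem_erase hx))
    rw [Finset.erase_insert hnm, Finset.insert_erase ha, Finset.insert_erase hC]

theorem stirling_succ_succ (n k : ℕ) :
    stirling (n + 1) (k + 1) = stirling n k + (k + 1) * stirling n (k + 1) := by
  rw [← card_partitionsK_singleton_mem n k, ← card_partitionsK_singleton_notMem n (k + 1),
    Finset.card_filter_add_card_filter_not, stirling]

theorem isPartition_empty_iff {S : Finset ℕ} : IsPartition ∅ S ↔ S = ∅ := by
  simp [IsPartition, eq_comm]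

theorem stirling_zero_zero : stirling 0 0 = 1 := by
  rw [stirling, Finset.card_eq_one]
  refine ⟨∅, Finset.ext fun P => ?_⟩
  rw [mem_partitionsK, Finset.card_eq_zero, Finset.mem_singleton]
  refine ⟨And.right, ?_⟩
  rintro rfl
  exact ⟨isPartition_empty_iff.2 (by simp [seg]), rfl⟩

theorem stirling_zero_succ (k : ℕ) : stirling 0 (k + 1) = 0 := by
  rw [stirling, Finset.card_eq_zero, Finset.eq_empty_iff_forall_notMem]
  intro P hP
  obtain ⟨hP, hc⟩ := mem_partitionsK.1 hP
  obtain ⟨B, hB⟩ := Finset.card_pos.1 (hc.symm ▸ k.succ_pos : 0 < P.card)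
  obtain ⟨x, hx⟩ := (isPartition_iff.1 hP).1 B hB
  simpa [seg] using hP.subset hB hx

theorem stirling_succ_zero (n : ℕ) : stirling (n + 1) 0 = 0 := by
  rw [stirling, Finset.card_eq_zero, Finset.eq_empty_iff_forall_notMem]
  intro P hP
  obtain ⟨hP, hc⟩ := mem_partitionsK.1 hP
  rw [Finset.card_eq_zero.1 hc, isPartition_empty_iff, seg_succ] at hP
  exact Finset.insert_ne_empty _ _ hP

theorem stirling_pos {n k : ℕ} (hk : 1 ≤ k) (hkn : k ≤ n) : 0 < stirling n k := by
  induction n generalizing k with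
  | zero => omega
  | succ n ih =>
    obtain ⟨j, rfl⟩ := Nat.exists_eq_add_of_le' hk
    rw [stirling_succ_succ]
    rcases Nat.eq_zero_or_pos j with rfl | hj
    · rcases Nat.eq_zero_or_pos n with rfl | hn
      · simp [stirling_zero_zero]
      · have := ih le_rfl hn
        positivity
    · have := ih hj (by omega)
      positivity

theorem eval_one_qS (n k : ℕ) : (qS n k).eval 1 = (stirling n k : ℚ) := by
  induction n generalizing k with
  | zero => cases k <;> simp [qS, stirling_zero_zero, stirling_zero_succ]
  | succ n ih =>
    cases k with
    | zero => simp [qS, stirling_succ_zero]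
    | succ k => simp [qS, stirling_succ_succ, ih, Polynomial.eval_finsetSum]

theorem derivative_qS_zero (n : ℕ) : Polynomial.derivative (qS n 0) = 0 := by
  cases n <;> simp [qS]

theorem eval_one_derivative_geom_sum (k : ℕ) :
    (Polynomial.derivative (∑ i ∈ Finset.range (k + 1), (Polynomial.X : Polynomial ℚ) ^ i)).eval 1
      = (k : ℚ) * (k + 1) / 2 := by
  induction k with
  | zero => simp
  | succ k ih =>
    rw [Finset.sum_range_succ, Polynomial.derivative_add, Polynomial.eval_add, ih,
      Polynomial.derivative_X_pow]
    simp
    ring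

theorem eval_one_derivative_qS_succ_succ (n k : ℕ) :
    (Polynomial.derivative (qS (n + 1) (k + 1))).eval 1 =
      (k : ℚ) * stirling n k + (Polynomial.derivative (qS n k)).eval 1 +
        ((k : ℚ) * (k + 1) / 2 * stirling n (k + 1) +
          (k + 1) * (Polynomial.derivative (qS n (k + 1))).eval 1) := by
  rw [qS, Polynomial.derivative_add, Polynomial.derivative_mul, Polynomial.derivative_mul]
  simp only [Polynomial.eval_add, Polynomial.eval_mul, eval_one_derivative_geom_sum, eval_one_qS,
    Polynomial.derivative_X_pow]
  simp [Polynomial.eval_finsetSum]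

theorem eval_one_derivative_qS_succ (n k : ℕ) :
    (Polynomial.derivative (qS n (k + 1))).eval 1 =
      ((n : ℚ) * k / 2 - (k + 1) * k / 4) * stirling n (k + 1) +
        ((n : ℚ) - k) / 2 * stirling n k := by
  induction n generalizing k with
  | zero => cases k <;> simp [qS, stirling_zero_succ]
  | succ n ih =>
    rw [eval_one_derivative_qS_succ_succ, ih]
    cases k with
    | zero =>
      rw [derivative_qS_zero, stirling_succ_zero]
      cases n <;> simp [stirling_succ_zero]
    | succ k =>
      rw [ih, stirling_succ_succ, stirling_succ_succ]
      push_cast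
      ring

/-- derivative of the `q`-Stirling polynomial at `q = 1`, and the average
value over `Π_n^k` of any statistic whose generating polynomial on `Π_n^k` is `S_{n,k}(q)`. -/
theorem qStirling_mean_over_partitionsK (n k : ℕ) (hk : 1 ≤ k) (hkn : k ≤ n) :
    (Polynomial.derivative (qS n k)).eval (1 : ℚ)
        = ((n : ℚ) * ((k : ℚ) - 1) / 2 - (k : ℚ) * ((k : ℚ) - 1) / 4) * (stirling n k : ℚ)
            + (((n : ℚ) + 1 - (k : ℚ)) / 2) * (stirling n (k-1) : ℚ) ∧
    ∀ stat : Finset (Finset ℕ) → ℕ,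
      (∑ π ∈ partitionsK n k, (Polynomial.X : Polynomial ℚ) ^ stat π) = qS n k →
      (∑ π ∈ partitionsK n k, (stat π : ℚ)) / (stirling n k : ℚ)
        = (n : ℚ) * ((k : ℚ) - 1) / 2 - (1/2) * (k.choose 2 : ℚ)
            + (((n : ℚ) + 1 - (k : ℚ)) / 2) * (stirling n (k-1) : ℚ) / (stirling n k : ℚ) := by
  have hderiv : (Polynomial.derivative (qS n k)).eval (1 : ℚ)
        = ((n : ℚ) * ((k : ℚ) - 1) / 2 - (k : ℚ) * ((k : ℚ) - 1) / 4) * (stirling n k : ℚ)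
            + (((n : ℚ) + 1 - (k : ℚ)) / 2) * (stirling n (k-1) : ℚ) := by
    obtain ⟨j, rfl⟩ := Nat.exists_eq_add_of_le' hk
    rw [eval_one_derivative_qS_succ, Nat.add_sub_cancel]
    push_cast
    ring
  refine ⟨hderiv, fun stat hstat => ?_⟩
  have hsum : ∑ π ∈ partitionsK n k, (stat π : ℚ) =
      (Polynomial.derivative (qS n k)).eval 1 := by
    simp [← hstat, Polynomial.eval_finsetSum, Polynomial.derivative_X_pow]
  have hpos : (stirling n k : ℚ) ≠ 0 := Nat.cast_ne_zero.2 (stirling_pos hk hkn).ne'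
  rw [hsum, hderiv, Nat.cast_choose_two]
  field_simp
  ring
end

section
/- Let μ_n = (Σ_{π ∈ Π_n} crol(π))/B_n be the average number of linear crossings in a random set partition of [n]. Then there exists a function ε : ℕ → ℝ with ε(n) → 0 as n → ∞ such that for all sufficiently large n, μ_n = (n²/(2·log n))·(1 + (log log n/log n)·(1 + ε(n))). -/
open scoped Classical

theorem mem_partitions_iff {n : ℕ} {P : Finset (Finset ℕ)} :
    P ∈ partitions n ↔ ∅ ∉ P ∧ (∀ B ∈ P, ∀ C ∈ P, ∀ x, x ∈ B → x ∈ C → B = C) ∧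
      ∀ x, (∃ B ∈ P, x ∈ B) ↔ 1 ≤ x ∧ x ≤ n := by
  have hdisj : (∀ B ∈ P, ∀ C ∈ P, B ≠ C → Disjoint B C) ↔
      ∀ B ∈ P, ∀ C ∈ P, ∀ x, x ∈ B → x ∈ C → B = C := by
    simp only [Finset.disjoint_left]
    exact ⟨fun h B hB C hC x hx hx' => by_contra fun hne => h B hB C hC hne hx hx',
      fun h B hB C hC hne x hx hx' => hne (h B hB C hC x hx hx')⟩
  have hunion : P.biUnion id = seg n ↔ ∀ x, (∃ B ∈ P, x ∈ B) ↔ 1 ≤ x ∧ x ≤ n := by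
    simp [Finset.ext_iff, seg]
  rw [← hdisj, ← hunion]
  rw [partitions, Finset.mem_filter, Finset.mem_powerset, IsPartition, and_iff_right_iff_imp]
  rintro ⟨-, -, h⟩ B hB
  rw [Finset.mem_powerset, ← h]
  exact Finset.subset_biUnion_of_mem id hB

theorem le_of_mem_partitions {n : ℕ} {P : Finset (Finset ℕ)} (hP : P ∈ partitions n)
    {B : Finset ℕ} (hB : B ∈ P) {x : ℕ} (hx : x ∈ B) : x ≤ n :=
  (((mem_partitions_iff.1 hP).2.2 x).1 ⟨B, hB, hx⟩).2

/-- Insert `N` into the block `B` of `P`; for `B = ∅` this adds the new block `{N}`. -/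
noncomputable def extendBlock (N : ℕ) (P : Finset (Finset ℕ)) (B : Finset ℕ) :
    Finset (Finset ℕ) :=
  insert (insert N B) (P.erase B)

theorem extendBlock_mem_partitions {n : ℕ} {P : Finset (Finset ℕ)} (hP : P ∈ partitions n)
    {B : Finset ℕ} (hB : B ∈ insert ∅ P) : extendBlock (n + 1) P B ∈ partitions (n + 1) := by
  obtain ⟨h0, hd, hu⟩ := mem_partitions_iff.1 hP
  have hN : ∀ C ∈ P, n + 1 ∉ C := fun C hC h => by
    have := le_of_mem_partitions hP hC h; omega
  rw [mem_partitions_iff]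
  refine ⟨?_, ?_, fun x => ?_⟩
  · grind [extendBlock]
  · intro C hC D hD x hx hx'
    rw [Finset.mem_insert] at hB
    simp only [extendBlock, Finset.mem_insert, Finset.mem_erase] at hC hD
    rcases hC with rfl | ⟨hC1, hC⟩ <;> rcases hD with rfl | ⟨hD1, hD⟩
    · rfl
    · grind
    · grind
    · exact hd C hC D hD x hx hx'
  · constructor
    · rintro ⟨C, hC, hx⟩
      simp only [extendBlock, Finset.mem_insert, Finset.mem_erase] at hC
      have hle : ∀ D ∈ P, ∀ y ∈ D, 1 ≤ y ∧ y ≤ n := fun D hD y hy => (hu y).1 ⟨D, hD, hy⟩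
      rcases hC with rfl | ⟨hC1, hC⟩
      · clear hu
        grind
      · have := hle C hC x hx
        omega
    · rintro ⟨h1, h2⟩
      by_cases hx : x = n + 1
      · exact ⟨insert (n + 1) B, by simp [extendBlock], by simp [hx]⟩
      · obtain ⟨C, hC, hxC⟩ := (hu x).2 ⟨h1, by omega⟩
        by_cases hCB : C = B
        · exact ⟨insert (n + 1) B, by simp [extendBlock], by simp [← hCB, hxC]⟩
        · exact ⟨C, by simp [extendBlock, hCB, hC], hxC⟩

theorem extendBlock_injective {n : ℕ} {P P' : Finset (Finset ℕ)} (hP : P ∈ partitions n)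
    (hP' : P' ∈ partitions n) {B B' : Finset ℕ} (hB : B ∈ insert ∅ P) (hB' : B' ∈ insert ∅ P')
    (h : extendBlock (n + 1) P B = extendBlock (n + 1) P' B') : P = P' ∧ B = B' := by
  have hN : ∀ C ∈ P, n + 1 ∉ C := fun C hC h => by
    have := le_of_mem_partitions hP hC h; omega
  have hN' : ∀ C ∈ P', n + 1 ∉ C := fun C hC h => by
    have := le_of_mem_partitions hP' hC h; omega
  have h0 := (mem_partitions_iff.1 hP).1
  have h0' := (mem_partitions_iff.1 hP').1
  have hNB : n + 1 ∉ B := by grind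
  have hNB' : n + 1 ∉ B' := by grind
  have h1 : insert (n + 1) B ∈ extendBlock (n + 1) P' B' := by rw [← h]; simp [extendBlock]
  have h2 : insert (n + 1) B = insert (n + 1) B' := by
    simp only [extendBlock, Finset.mem_insert, Finset.mem_erase] at h1
    rcases h1 with h1 | ⟨-, h1⟩
    · exact h1
    · exact absurd (Finset.mem_insert_self _ _) (hN' _ h1)
  have h3 : B = B' := by
    rw [← Finset.erase_insert hNB, h2, Finset.erase_insert hNB']
  subst h3
  refine ⟨?_, rfl⟩
  have h4 : P.erase B = P'.erase B := by
    rw [extendBlock, extendBlock] at h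
    rw [← Finset.erase_insert (s := P.erase B) (a := insert (n + 1) B), h, Finset.erase_insert]
    · exact fun hh => hN' _ (Finset.mem_of_mem_erase hh) (Finset.mem_insert_self _ _)
    · exact fun hh => hN _ (Finset.mem_of_mem_erase hh) (Finset.mem_insert_self _ _)
  ext C
  have h5 : C ∈ P.erase B ↔ C ∈ P'.erase B := by rw [h4]
  grind

theorem exists_extendBlock_eq {n : ℕ} {Q : Finset (Finset ℕ)} (hQ : Q ∈ partitions (n + 1)) :
    ∃ P ∈ partitions n, ∃ B ∈ insert ∅ P, extendBlock (n + 1) P B = Q := by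
  obtain ⟨h0, hd, hu⟩ := mem_partitions_iff.1 hQ
  obtain ⟨C, hC, hNC⟩ := (hu (n + 1)).2 ⟨by omega, le_rfl⟩
  have hN : ∀ D ∈ Q, D ≠ C → n + 1 ∉ D := fun D hD hne h => hne (hd D hD C hC _ h hNC)
  have hB : C.erase (n + 1) ∈ Q → C.erase (n + 1) = ∅ := fun h => by
    by_contra hne
    obtain ⟨x, hx⟩ := Finset.nonempty_iff_ne_empty.2 hne
    have := hd _ h C hC x hx (Finset.mem_of_mem_erase hx)
    rw [← this] at hNC
    simp at hNC
  refine ⟨(insert (C.erase (n + 1)) (Q.erase C)).erase ∅, ?_, C.erase (n + 1), ?_, ?_⟩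
  · rw [mem_partitions_iff]
    refine ⟨by simp, ?_, fun x => ?_⟩
    · intro D hD E hE x hx hx'
      simp only [Finset.mem_insert, Finset.mem_erase] at hD hE
      rcases hD with ⟨-, rfl | ⟨hD1, hD⟩⟩ <;> rcases hE with ⟨-, rfl | ⟨hE1, hE⟩⟩
      · rfl
      · exact absurd (hd _ hE C hC x hx' (Finset.mem_of_mem_erase hx)) hE1
      · exact absurd (hd _ hD C hC x hx (Finset.mem_of_mem_erase hx')) hD1
      · exact hd D hD E hE x hx hx'
    · constructor
      · rintro ⟨D, hD, hx⟩
        simp only [Finset.mem_insert, Finset.mem_erase] at hD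
        rcases hD with ⟨-, rfl | ⟨hD1, hD⟩⟩
        · have := (hu x).1 ⟨C, hC, Finset.mem_of_mem_erase hx⟩
          have := Finset.ne_of_mem_erase hx
          omega
        · have := (hu x).1 ⟨D, hD, hx⟩
          have : x ≠ n + 1 := fun h => hN D hD hD1 (h ▸ hx)
          omega
      · rintro ⟨h1, h2⟩
        obtain ⟨D, hD, hx⟩ := (hu x).2 ⟨h1, by omega⟩
        by_cases hDC : D = C
        · subst hDC
          refine ⟨D.erase (n + 1), ?_, Finset.mem_erase.2 ⟨by omega, hx⟩⟩
          simp only [Finset.mem_erase, Finset.mem_insert, true_or, and_true]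
          exact Finset.ne_empty_of_mem (Finset.mem_erase.2 ⟨by omega, hx⟩)
        · exact ⟨D, by simp [hDC, hD, Finset.ne_empty_of_mem hx], hx⟩
  · by_cases h : C.erase (n + 1) = ∅ <;> simp [h]
  · rw [extendBlock, Finset.insert_erase hNC]
    ext D
    simp only [Finset.mem_insert, Finset.mem_erase]
    grind

theorem sum_partitions_succ (n : ℕ) (F : Finset (Finset ℕ) → ℝ) :
    ∑ Q ∈ partitions (n + 1), F Q = ∑ P ∈ partitions n,
      (F (extendBlock (n + 1) P ∅) + ∑ B ∈ P, F (extendBlock (n + 1) P B)) := by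
  have h1 : ∑ P ∈ partitions n,
      (F (extendBlock (n + 1) P ∅) + ∑ B ∈ P, F (extendBlock (n + 1) P B)) =
      ∑ P ∈ partitions n, ∑ B ∈ insert ∅ P, F (extendBlock (n + 1) P B) :=
    Finset.sum_congr rfl fun P hP => by
      rw [Finset.sum_insert (mem_partitions_iff.1 hP).1]
  rw [h1, Finset.sum_sigma']
  symm
  refine Finset.sum_bij (fun x _ => extendBlock (n + 1) x.1 x.2) ?_ ?_ ?_ fun _ _ => rfl
  · rintro ⟨P, B⟩ h
    rw [Finset.mem_sigma] at h
    exact extendBlock_mem_partitions h.1 h.2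
  · rintro ⟨P, B⟩ h ⟨P', B'⟩ h' heq
    rw [Finset.mem_sigma] at h h'
    obtain ⟨rfl, rfl⟩ := extendBlock_injective h.1 h'.1 h.2 h'.2 heq
    rfl
  · intro Q hQ
    obtain ⟨P, hP, B, hB, h⟩ := exists_extendBlock_eq hQ
    exact ⟨⟨P, B⟩, Finset.mem_sigma.2 ⟨hP, hB⟩, h⟩

theorem partitions_zero : partitions 0 = {∅} := by
  ext P
  rw [mem_partitions_iff, Finset.mem_singleton]
  constructor
  · rintro ⟨h0, -, hu⟩
    refine Finset.eq_empty_of_forall_notMem fun B hB => ?_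
    obtain ⟨x, hx⟩ := Finset.nonempty_iff_ne_empty.2 fun h => h0 (h ▸ hB)
    have := (hu x).1 ⟨B, hB, hx⟩
    omega
  · rintro rfl
    simp
    omega

theorem card_extendBlock_empty {n : ℕ} {P : Finset (Finset ℕ)} (hP : P ∈ partitions n) :
    (extendBlock (n + 1) P ∅).card = P.card + 1 := by
  rw [extendBlock, Finset.card_insert_of_notMem, Finset.erase_eq_of_notMem
    (mem_partitions_iff.1 hP).1]
  intro h
  have := le_of_mem_partitions hP (Finset.mem_of_mem_erase h) (Finset.mem_insert_self _ _)
  omega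

theorem card_extendBlock {n : ℕ} {P : Finset (Finset ℕ)} (hP : P ∈ partitions n)
    {B : Finset ℕ} (hB : B ∈ P) : (extendBlock (n + 1) P B).card = P.card := by
  rw [extendBlock, Finset.card_insert_of_notMem, Finset.card_erase_add_one hB]
  intro h
  have := le_of_mem_partitions hP (Finset.mem_of_mem_erase h) (Finset.mem_insert_self _ _)
  omega

/-- The falling factorial `x (x - 1) ⋯ (x - k + 1)`. -/
noncomputable def fallFac (x : ℝ) (k : ℕ) : ℝ := ∏ i ∈ Finset.range k, (x - i)

theorem fallFac_succ (x : ℝ) (k : ℕ) : fallFac x (k + 1) = fallFac x k * (x - k) :=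
  Finset.prod_range_succ _ _

theorem fallFac_succ' (x : ℝ) (k : ℕ) : fallFac x (k + 1) = x * fallFac (x - 1) k := by
  rw [fallFac, Finset.prod_range_succ', mul_comm, fallFac]
  congr 1
  · simp
  · refine Finset.prod_congr rfl fun i _ => ?_
    push_cast
    ring

/-- The sum of `f P * fallFac x |P|` over the set partitions `P` of `[n]`. -/
noncomputable def fallSum (f : Finset (Finset ℕ) → ℝ) (n : ℕ) (x : ℝ) : ℝ :=
  ∑ P ∈ partitions n, f P * fallFac x P.card

theorem sum_mul_fallFac_succ (f : Finset (Finset ℕ) → ℝ) (n : ℕ) (x : ℝ) :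
    ∑ P ∈ partitions n, f P * fallFac x (P.card + 1) = x * fallSum f n (x - 1) := by
  rw [fallSum, Finset.mul_sum]
  refine Finset.sum_congr rfl fun P _ => ?_
  rw [fallFac_succ']
  ring

theorem fallSum_succ (f g h : Finset (Finset ℕ) → ℝ) (n : ℕ) (x : ℝ)
    (hg : ∀ P ∈ partitions n, f (extendBlock (n + 1) P ∅) = f P + g P)
    (hh : ∀ P ∈ partitions n, ∑ B ∈ P, f (extendBlock (n + 1) P B) = P.card * f P + h P) :
    fallSum f (n + 1) x = x * fallSum f n x + x * fallSum g n (x - 1) + fallSum h n x := by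
  rw [← sum_mul_fallFac_succ]
  simp only [fallSum]
  rw [sum_partitions_succ, Finset.mul_sum, ← Finset.sum_add_distrib, ← Finset.sum_add_distrib]
  refine Finset.sum_congr rfl fun P hP => ?_
  have h1 : ∑ B ∈ P, f (extendBlock (n + 1) P B) * fallFac x (extendBlock (n + 1) P B).card =
      (∑ B ∈ P, f (extendBlock (n + 1) P B)) * fallFac x P.card := by
    rw [Finset.sum_mul]
    exact Finset.sum_congr rfl fun B hB => by rw [card_extendBlock hP hB]
  rw [h1, hg P hP, hh P hP, card_extendBlock_empty hP, fallFac_succ]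
  ring

theorem fallSum_zero (f : Finset (Finset ℕ) → ℝ) (x : ℝ) : fallSum f 0 x = f ∅ := by
  simp [fallSum, partitions_zero, fallFac]

theorem fallSum_const_zero (n : ℕ) (x : ℝ) : fallSum (fun _ => 0) n x = 0 := by
  simp [fallSum]

theorem fallSum_one (n : ℕ) (x : ℝ) : fallSum (fun _ => 1) n x = x ^ n := by
  induction n with
  | zero => simp [fallSum_zero]
  | succ n ih =>
    rw [fallSum_succ (fun _ => 1) (fun _ => 0) (fun _ => 0) n x (by simp) (by simp), ih,
      fallSum_const_zero, fallSum_const_zero]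
    ring

theorem fallSum_card (n : ℕ) (x : ℝ) :
    fallSum (fun P => P.card) n x = x * (x ^ n - (x - 1) ^ n) := by
  induction n with
  | zero => simp [fallSum_zero]
  | succ n ih =>
    rw [fallSum_succ (fun P => P.card) (fun _ => 1) (fun _ => 0) n x, ih,
      fallSum_one, fallSum_const_zero]
    · ring
    · intro P hP
      simp [card_extendBlock_empty hP]
    · intro P hP
      rw [Finset.sum_congr rfl fun B hB => by rw [card_extendBlock hP hB]]
      simp

theorem fallSum_const_mul (c : ℝ) (f : Finset (Finset ℕ) → ℝ) (n : ℕ) (x : ℝ) :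
    fallSum (fun P => c * f P) n x = c * fallSum f n x := by
  simp only [fallSum, Finset.mul_sum, mul_assoc]

theorem fallSum_sub (f g : Finset (Finset ℕ) → ℝ) (n : ℕ) (x : ℝ) :
    fallSum (fun P => f P - g P) n x = fallSum f n x - fallSum g n x := by
  simp only [fallSum, sub_mul, Finset.sum_sub_distrib]

theorem fallSum_card_mul_card_sub_one (n : ℕ) (x : ℝ) :
    fallSum (fun P => P.card * (P.card - 1)) n x =
      x * (x - 1) * (x ^ n - 2 * (x - 1) ^ n + (x - 2) ^ n) := by
  induction n with
  | zero => norm_num [fallSum_zero]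
  | succ n ih =>
    rw [fallSum_succ (fun P => P.card * (P.card - 1)) (fun P => 2 * P.card) (fun _ => 0) n x,
      ih, fallSum_const_mul, fallSum_card, fallSum_const_zero]
    · ring
    · intro P hP
      rw [card_extendBlock_empty hP]
      push_cast
      ring
    · intro P hP
      rw [Finset.sum_congr rfl fun B hB => by rw [card_extendBlock hP hB]]
      simp

/-- Every element of `B` is below every element of `C`. -/
def Precedes (B C : Finset ℕ) : Prop := ∀ b ∈ B, ∀ c ∈ C, b < c

/-- `C` has elements on both sides of `m`. -/
def Straddles (C : Finset ℕ) (m : ℕ) : Prop := (∃ c ∈ C, c < m) ∧ ∃ c ∈ C, m < c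

/-- The number of ordered pairs of blocks `(B, C)` with every element of `B` below every
element of `C`. -/
noncomputable def precCount (P : Finset (Finset ℕ)) : ℝ :=
  ∑ B ∈ P, ∑ C ∈ P, if Precedes B C then 1 else 0

/-- The number of blocks of `P` having elements on both sides of `m`. -/
noncomputable def straddleCount (P : Finset (Finset ℕ)) (m : ℕ) : ℝ :=
  ∑ C ∈ P, if Straddles C m then 1 else 0

theorem sup_mem_of_mem_partitions {n : ℕ} {P : Finset (Finset ℕ)} (hP : P ∈ partitions n)
    {B : Finset ℕ} (hB : B ∈ P) : B.sup id ∈ B := by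
  have h : B.Nonempty :=
    Finset.nonempty_iff_ne_empty.2 fun h => (mem_partitions_iff.1 hP).1 (h ▸ hB)
  rw [← Finset.sup'_eq_sup h]
  obtain ⟨b, hb, h⟩ := Finset.exists_mem_eq_sup' h id
  rwa [h]

theorem precCount_add_straddleCount {n : ℕ} {P : Finset (Finset ℕ)} (hP : P ∈ partitions n) :
    2 * precCount P + 2 * ∑ B ∈ P, straddleCount P (B.sup id) =
      (P.card : ℝ) * (P.card - 1) := by
  obtain ⟨h0, hd, -⟩ := mem_partitions_iff.1 hP
  have key : ∀ B ∈ P, ∀ C ∈ P,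
      ((((if Precedes B C then 1 else 0) +
        (if Precedes C B then 1 else 0)) +
        (if Straddles C (B.sup id) then 1 else 0)) +
        (if Straddles B (C.sup id) then 1 else 0) : ℝ) =
        1 - if B = C then 1 else 0 := by
    intro B hB C hC
    have hBm := sup_mem_of_mem_partitions hP hB
    have hCm := sup_mem_of_mem_partitions hP hC
    have hBle : ∀ b ∈ B, b ≤ B.sup id := fun b hb => Finset.le_sup (f := id) hb
    have hCle : ∀ b ∈ C, b ≤ C.sup id := fun b hb => Finset.le_sup (f := id) hb
    generalize B.sup id = M at *
    generalize C.sup id = N at *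
    by_cases hBC : B = C
    · subst hBC
      have h1 : ¬ Precedes B B := fun h => lt_irrefl _ (h _ hBm _ hBm)
      have h2 : ¬ ∃ c ∈ B, M < c := fun ⟨c, hc, h⟩ => absurd (hBle c hc) (by omega)
      have h3 : ¬ ∃ c ∈ B, N < c := fun ⟨c, hc, h⟩ => absurd (hCle c hc) (by omega)
      rw [if_neg h1, if_neg fun h => h2 h.2, if_neg fun h => h3 h.2]
      simp
    · have hne : ∀ b ∈ B, ∀ c ∈ C, b ≠ c := fun b hb c hc h => hBC (hd B hB C hC b hb (h ▸ hc))
      rw [if_neg hBC]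
      have hMN := hne _ hBm _ hCm
      by_cases h1 : Precedes B C
      · rw [if_pos h1, if_neg, if_neg, if_neg]
        · norm_num
        · rintro ⟨-, c, hc, h⟩
          have := h1 c hc _ hCm
          omega
        · rintro ⟨⟨c, hc, h⟩, -⟩
          have := h1 _ hBm c hc
          omega
        · intro h
          have := h1 _ hBm _ hCm
          have := h _ hCm _ hBm
          omega
      by_cases h2 : Precedes C B
      · rw [if_neg h1, if_pos h2, if_neg, if_neg]
        · norm_num
        · rintro ⟨⟨c, hc, h⟩, -⟩
          have := h2 _ hCm c hc
          omega
        · rintro ⟨-, c, hc, h⟩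
          have := h2 c hc _ hBm
          omega
      rw [if_neg h1, if_neg h2]
      simp only [Precedes] at h1 h2
      push Not at h1 h2
      obtain ⟨b, hb, c, hc, h1⟩ := h1
      obtain ⟨c', hc', b', hb', h2⟩ := h2
      have e1 := hne b hb c hc
      have e2 := hne b' hb' c' hc'
      have := hBle b hb
      have := hBle b' hb'
      have := hCle c hc
      have := hCle c' hc'
      rcases lt_or_gt_of_ne hMN with h | h
      · rw [if_pos ⟨⟨c, hc, by omega⟩, N, hCm, h⟩, if_neg]
        · norm_num
        · rintro ⟨-, d, hd, h⟩
          have := hBle d hd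
          omega
      · rw [if_neg, if_pos ⟨⟨b', hb', by omega⟩, M, hBm, h⟩]
        · norm_num
        · rintro ⟨-, d, hd, h⟩
          have := hCle d hd
          omega
  have hsum := Finset.sum_congr rfl fun B hB => Finset.sum_congr (s₁ := P) rfl (key B hB)
  simp only [Finset.sum_add_distrib, Finset.sum_sub_distrib] at hsum
  have hswap : ∀ f : Finset ℕ → Finset ℕ → ℝ,
      ∑ B ∈ P, ∑ C ∈ P, f C B = ∑ B ∈ P, ∑ C ∈ P, f B C := fun f => Finset.sum_comm
  rw [hswap fun B C => if Precedes B C then 1 else 0,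
    hswap fun B C => if Straddles C (B.sup id) then 1 else 0] at hsum
  have hdiag : ∑ B ∈ P, ∑ C ∈ P, (if B = C then (1 : ℝ) else 0) = P.card := by simp
  rw [hdiag] at hsum
  simp only [Finset.sum_const, nsmul_eq_mul, mul_one] at hsum
  simp only [precCount, straddleCount]
  linarith

theorem precCount_extendBlock_empty {n : ℕ} {P : Finset (Finset ℕ)} (hP : P ∈ partitions n) :
    precCount (extendBlock (n + 1) P ∅) = precCount P + P.card := by
  have h0 := (mem_partitions_iff.1 hP).1
  have hN : insert (n + 1) ∅ ∉ P := fun h => by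
    have := le_of_mem_partitions hP h (Finset.mem_insert_self _ _)
    omega
  rw [precCount, extendBlock, Finset.erase_eq_of_notMem h0, Finset.sum_insert hN,
    Finset.sum_insert hN]
  simp only [Finset.sum_insert hN, Finset.sum_add_distrib]
  have h1 : ∑ B ∈ P, (if Precedes B (insert (n + 1) ∅) then (1 : ℝ) else 0) =
      P.card := by
    rw [Finset.sum_congr rfl fun B hB => if_pos ?_]
    · simp
    · intro b hb c hc
      have := le_of_mem_partitions hP hB hb
      simp at hc
      omega
  have h2 : ∑ C ∈ P, (if Precedes (insert (n + 1) ∅) C then (1 : ℝ) else 0)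
      = 0 := by
    refine Finset.sum_eq_zero fun C hC => if_neg fun h => ?_
    have h3 := sup_mem_of_mem_partitions hP hC
    have := h (n + 1) (by simp) _ h3
    have := le_of_mem_partitions hP hC h3
    omega
  rw [h1, h2, if_neg (by simp [Precedes]), precCount]
  ring

theorem precCount_extendBlock {n : ℕ} {P : Finset (Finset ℕ)} (hP : P ∈ partitions n)
    {B : Finset ℕ} (hB : B ∈ P) :
    precCount (extendBlock (n + 1) P B) =
      precCount P - ∑ C ∈ P, if Precedes B C then 1 else 0 := by
  have hBm := sup_mem_of_mem_partitions hP hB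
  have hN : insert (n + 1) B ∉ P.erase B := fun h => by
    have := le_of_mem_partitions hP (Finset.mem_of_mem_erase h) (Finset.mem_insert_self _ _)
    omega
  have h2 : ∑ C ∈ P.erase B, (if Precedes (insert (n + 1) B) C then (1 : ℝ) else 0)
      = 0 := by
    refine Finset.sum_eq_zero fun C hC => if_neg fun h => ?_
    have hC := Finset.mem_of_mem_erase hC
    have h3 := sup_mem_of_mem_partitions hP hC
    have := h (n + 1) (by simp) _ h3
    have := le_of_mem_partitions hP hC h3
    omega
  have h1 : ∀ A ∈ P, (if Precedes A (insert (n + 1) B) then (1 : ℝ) else 0) =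
      if Precedes A B then (1 : ℝ) else 0 := by
    intro A hA
    refine if_congr ⟨fun h b hb c hc => h b hb c (Finset.mem_insert_of_mem hc),
      fun h b hb c hc => ?_⟩ rfl rfl
    rcases Finset.mem_insert.1 hc with rfl | hc
    · have := le_of_mem_partitions hP hA hb
      omega
    · exact h b hb c hc
  have h3 : ¬ Precedes (insert (n + 1) B) (insert (n + 1) B) := fun h =>
    lt_irrefl _ (h (n + 1) (by simp) (n + 1) (by simp))
  have hP' : P = insert B (P.erase B) := (Finset.insert_erase hB).symm
  rw [precCount, extendBlock, Finset.sum_insert hN, Finset.sum_insert hN, h2, if_neg h3]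
  simp only [Finset.sum_insert hN]
  rw [Finset.sum_congr rfl fun A hA => by rw [h1 A (Finset.mem_of_mem_erase hA)]]
  rw [precCount, ← Finset.add_sum_erase P _ hB, zero_add, zero_add, add_sub_cancel_left]
  refine Finset.sum_congr rfl fun A _ => ?_
  rw [← Finset.add_sum_erase P _ hB]

theorem fallSum_precCount (n : ℕ) (x : ℝ) :
    fallSum precCount n x =
      x * (n * (x - 1) ^ n - (x - 1) ^ (n + 1) + (x - 1) * (x - 2) ^ n) := by
  induction n with
  | zero => simp [fallSum_zero, precCount]
  | succ n ih =>
    rw [fallSum_succ precCount (fun P => P.card) (fun P => -1 * precCount P) n x,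
      fallSum_const_mul, fallSum_card]
    · push_cast
      linear_combination (x - 1) * ih
    · exact fun P hP => precCount_extendBlock_empty hP
    · intro P hP
      rw [Finset.sum_congr rfl fun B hB => precCount_extendBlock hP hB, Finset.sum_sub_distrib]
      simp only [Finset.sum_const, nsmul_eq_mul, precCount]
      ring

theorem isEdge_le {n : ℕ} {P : Finset (Finset ℕ)} (hP : P ∈ partitions n) {i j : ℕ}
    (h : IsEdge P i j) : i < j ∧ j ≤ n := by
  obtain ⟨hij, B, hB, -, hj, -⟩ := h
  exact ⟨hij, le_of_mem_partitions hP hB hj⟩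

theorem isEdge_extendBlock_empty {n : ℕ} {P : Finset (Finset ℕ)} (hP : P ∈ partitions n)
    (i j : ℕ) : IsEdge (extendBlock (n + 1) P ∅) i j ↔ IsEdge P i j := by
  rw [extendBlock, Finset.erase_eq_of_notMem (mem_partitions_iff.1 hP).1]
  constructor
  · rintro ⟨hij, B, hB, hi, hj, hB'⟩
    rcases Finset.mem_insert.1 hB with rfl | hB
    · simp at hi hj
      omega
    · exact ⟨hij, B, hB, hi, hj, hB'⟩
  · rintro ⟨hij, B, hB, h⟩
    exact ⟨hij, B, Finset.mem_insert_of_mem hB, h⟩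

theorem isEdge_extendBlock {n : ℕ} {P : Finset (Finset ℕ)} (hP : P ∈ partitions n)
    {B : Finset ℕ} (hB : B ∈ P) (i j : ℕ) :
    IsEdge (extendBlock (n + 1) P B) i j ↔ IsEdge P i j ∨ i = B.sup id ∧ j = n + 1 := by
  have hBm := sup_mem_of_mem_partitions hP hB
  have hBle : ∀ b ∈ B, b ≤ B.sup id := fun b hb => Finset.le_sup (f := id) hb
  have hBn : ∀ b ∈ B, b ≤ n := fun b hb => le_of_mem_partitions hP hB hb
  generalize B.sup id = M at *
  constructor
  · rintro ⟨hij, C, hC, hi, hj, hC'⟩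
    simp only [extendBlock, Finset.mem_insert, Finset.mem_erase] at hC
    rcases hC with rfl | ⟨-, hC⟩
    · rcases Finset.mem_insert.1 hj with rfl | hj
      · right
        have hi' : i ∈ B := Finset.mem_of_mem_insert_of_ne hi (by omega)
        have := hBle i hi'
        have := hBn M hBm
        have := hC' M (Finset.mem_insert_of_mem hBm)
        omega
      · left
        have := hBn j hj
        exact ⟨hij, B, hB, Finset.mem_of_mem_insert_of_ne hi (by omega), hj,
          fun p hp => hC' p (Finset.mem_insert_of_mem hp)⟩
    · exact Or.inl ⟨hij, C, hC, hi, hj, hC'⟩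
  · rintro (⟨hij, C, hC, hi, hj, hC'⟩ | ⟨rfl, rfl⟩)
    · by_cases hCB : C = B
      · subst hCB
        refine ⟨hij, insert (n + 1) C, by simp [extendBlock], Finset.mem_insert_of_mem hi,
          Finset.mem_insert_of_mem hj, fun p hp => ?_⟩
        rcases Finset.mem_insert.1 hp with rfl | hp
        · have := hBn j hj
          omega
        · exact hC' p hp
      · exact ⟨hij, C, by simp [extendBlock, hCB, hC], hi, hj, hC'⟩
    · have := hBn i hBm
      refine ⟨by omega, insert (n + 1) B, by simp [extendBlock], Finset.mem_insert_of_mem hBm,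
        Finset.mem_insert_self _ _, fun p hp => ?_⟩
      rcases Finset.mem_insert.1 hp with rfl | hp
      · omega
      · have := hBle p hp
        omega

/-- The set of linear crossings of `P`. -/
def crossings (P : Finset (Finset ℕ)) : Set ((ℕ × ℕ) × ℕ × ℕ) :=
  {e | IsEdge P e.1.1 e.1.2 ∧ IsEdge P e.2.1 e.2.2 ∧
    e.1.1 < e.2.1 ∧ e.2.1 < e.1.2 ∧ e.1.2 < e.2.2}

theorem crol_eq_ncard (P : Finset (Finset ℕ)) : crol P = (crossings P).ncard :=
  Nat.card_coe_set_eq (crossings P)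

theorem finite_crossings {n : ℕ} {P : Finset (Finset ℕ)} (hP : P ∈ partitions n) :
    (crossings P).Finite := by
  have h := Set.finite_Iic n
  refine ((h.prod h).prod (h.prod h)).subset ?_
  rintro ⟨⟨i, j⟩, k, l⟩ ⟨h1, h2, -⟩
  have := isEdge_le hP h1
  have := isEdge_le hP h2
  simp only [Set.mem_prod, Set.mem_Iic] at *
  omega

theorem crol_extendBlock_empty {n : ℕ} {P : Finset (Finset ℕ)} (hP : P ∈ partitions n) :
    crol (extendBlock (n + 1) P ∅) = crol P := by
  simp only [crol_eq_ncard, crossings, isEdge_extendBlock_empty hP]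

/-- The edges `(i, j)` of `P` with `i < m < j`. -/
def edgesOver (P : Finset (Finset ℕ)) (m : ℕ) : Set (ℕ × ℕ) :=
  {e | IsEdge P e.1 e.2 ∧ e.1 < m ∧ m < e.2}

theorem crol_extendBlock {n : ℕ} {P : Finset (Finset ℕ)} (hP : P ∈ partitions n)
    {B : Finset ℕ} (hB : B ∈ P) :
    crol (extendBlock (n + 1) P B) = crol P + (edgesOver P (B.sup id)).ncard := by
  have hMn : B.sup id ≤ n := le_of_mem_partitions hP hB (sup_mem_of_mem_partitions hP hB)
  have hunion : crossings (extendBlock (n + 1) P B) =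
      crossings P ∪ (fun e => (e, (B.sup id, n + 1))) '' edgesOver P (B.sup id) := by
    ext ⟨⟨i, j⟩, k, l⟩
    simp only [crossings, edgesOver, isEdge_extendBlock hP hB, Set.mem_union, Set.mem_image,
      Set.mem_ofPred_eq, Prod.exists, Prod.mk.injEq]
    generalize B.sup id = M at *
    constructor
    · rintro ⟨h1 | ⟨rfl, rfl⟩, h2 | ⟨rfl, rfl⟩, h3, h4, h5⟩
      · exact Or.inl ⟨h1, h2, h3, h4, h5⟩
      · exact Or.inr ⟨i, j, ⟨h1, h3, h4⟩, ⟨rfl, rfl⟩, rfl, rfl⟩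
      · have := isEdge_le hP h2
        omega
      · omega
    · rintro (⟨h1, h2, h3⟩ | ⟨i, j, ⟨h1, h2, h3⟩, ⟨rfl, rfl⟩, rfl, rfl⟩)
      · exact ⟨Or.inl h1, Or.inl h2, h3⟩
      · have := isEdge_le hP h1
        exact ⟨Or.inl h1, Or.inr ⟨rfl, rfl⟩, h2, h3, by omega⟩
  have hinj : Function.Injective fun e : ℕ × ℕ => (e, (B.sup id, n + 1)) := fun e e' h =>
    (Prod.mk.inj h).1
  have hfin : (edgesOver P (B.sup id)).Finite := by
    have h := Set.finite_Iic n
    refine (h.prod h).subset ?_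
    rintro ⟨i, j⟩ ⟨h1, -⟩
    have := isEdge_le hP h1
    simp only [Set.mem_prod, Set.mem_Iic] at *
    omega
  rw [crol_eq_ncard, crol_eq_ncard, hunion, Set.ncard_union_eq _ (finite_crossings hP)
    (hfin.image _), Set.ncard_image_of_injective _ hinj]
  rw [Set.disjoint_left]
  rintro e ⟨-, h, -⟩ ⟨e', -, rfl⟩
  have := isEdge_le hP h
  simp at this

theorem exists_consecutive_of_straddles {C : Finset ℕ} {m : ℕ} (h : Straddles C m)
    (hm : m ∉ C) : ∃ e : ℕ × ℕ, e.1 ∈ C ∧ e.2 ∈ C ∧ e.1 < m ∧ m < e.2 ∧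
      ∀ p ∈ C, ¬(e.1 < p ∧ p < e.2) := by
  obtain ⟨⟨a, ha, ham⟩, b, hb, hbm⟩ := h
  obtain ⟨i, hi, hi'⟩ := (C.filter (· < m)).exists_max_image id ⟨a, by simp [ha, ham]⟩
  obtain ⟨j, hj, hj'⟩ := (C.filter (m < ·)).exists_min_image id ⟨b, by simp [hb, hbm]⟩
  simp only [Finset.mem_filter, id] at hi hj hi' hj'
  refine ⟨(i, j), hi.1, hj.1, hi.2, hj.2, fun p hp => ?_⟩
  have hpm : p ≠ m := fun h => hm (h ▸ hp)
  rintro ⟨h1, h2⟩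
  rcases lt_or_gt_of_ne hpm with h | h
  · have := hi' p ⟨hp, h⟩
    omega
  · have := hj' p ⟨hp, h⟩
    omega

theorem ncard_edgesOver {n : ℕ} {P : Finset (Finset ℕ)} (hP : P ∈ partitions n)
    {B : Finset ℕ} (hB : B ∈ P) :
    ((edgesOver P (B.sup id)).ncard : ℝ) = straddleCount P (B.sup id) := by
  obtain ⟨-, hd, -⟩ := mem_partitions_iff.1 hP
  have hBm := sup_mem_of_mem_partitions hP hB
  have hBle : ∀ b ∈ B, b ≤ B.sup id := fun b hb => Finset.le_sup (f := id) hb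
  generalize B.sup id = M at *
  have hex : ∀ C ∈ {C | C ∈ P ∧ Straddles C M}, ∃ e : ℕ × ℕ, e.1 ∈ C ∧ e.2 ∈ C ∧
      e.1 < M ∧ M < e.2 ∧ ∀ p ∈ C, ¬(e.1 < p ∧ p < e.2) := by
    rintro C ⟨hC, hCM⟩
    refine exists_consecutive_of_straddles hCM fun hM => ?_
    obtain rfl := hd B hB C hC M hBm hM
    obtain ⟨-, c, hc, h⟩ := hCM
    have := hBle c hc
    omega
  choose f hf using hex
  rw [← Set.ncard_congr f]
  · have hset : {C | C ∈ P ∧ Straddles C M} = ↑(P.filter fun C => Straddles C M) := by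
      ext C
      simp
    rw [hset, Set.ncard_coe_finset, straddleCount, Finset.sum_boole]
  · rintro C hC
    obtain ⟨h1, h2, h3, h4, h5⟩ := hf C hC
    exact ⟨⟨by omega, C, hC.1, h1, h2, h5⟩, h3, h4⟩
  · intro C C' hC hC' h
    exact hd C hC.1 C' hC'.1 _ (hf C hC).1 (h ▸ (hf C' hC').1)
  · rintro ⟨i, j⟩ ⟨⟨hij, C, hC, hi, hj, h5⟩, hiM, hMj⟩
    have hCs : C ∈ {C | C ∈ P ∧ Straddles C M} := ⟨hC, ⟨i, hi, hiM⟩, j, hj, hMj⟩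
    refine ⟨C, hCs, ?_⟩
    obtain ⟨h1, h2, h3, h4, h6⟩ := hf C hCs
    have a1 := h5 _ h1
    have a2 := h5 _ h2
    have a3 := h6 _ hi
    have a4 := h6 _ hj
    simp only at hij hiM hMj
    ext <;> simp only <;> omega

theorem fallSum_crol (n : ℕ) (x : ℝ) :
    fallSum (fun P => crol P) n x =
      n / 2 * (x - 1) * x ^ n - 5 / 4 * (x * (x - 1) * x ^ n) +
        1 / 4 * (x * (x - 1) * (x - 2) ^ n) + x * (x - 1) ^ (n + 1) + n * (x * (x - 1) ^ n) := by
  induction n with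
  | zero =>
    have h : crossings ∅ = ∅ := by
      ext e
      simp [crossings, IsEdge]
    rw [fallSum_zero, crol_eq_ncard, h]
    simp
    ring
  | succ n ih =>
    rw [fallSum_succ (fun P => crol P) (fun _ => 0)
      (fun P => 1 / 2 * ((P.card : ℝ) * (P.card - 1)) - precCount P) n x, fallSum_sub,
      fallSum_const_mul, fallSum_card_mul_card_sub_one, fallSum_precCount, fallSum_const_zero, ih]
    · push_cast
      ring
    · intro P hP
      simp [crol_extendBlock_empty hP]
    · intro P hP
      rw [Finset.sum_congr rfl fun B hB => by
        rw [crol_extendBlock hP hB, Nat.cast_add, ncard_edgesOver hP hB], Finset.sum_add_distrib,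
        ← precCount_add_straddleCount hP]
      simp only [Finset.sum_const, nsmul_eq_mul]
      ring

theorem hasSum_mul_shift_div_factorial {g : ℝ → ℝ} {a : ℝ}
    (h : HasSum (fun m : ℕ => g m / m.factorial) a) :
    HasSum (fun m : ℕ => m * g (m - 1) / m.factorial) a := by
  rw [← hasSum_nat_add_iff' 1]
  simp only [Finset.range_one, Finset.sum_singleton, Nat.cast_zero, zero_mul, zero_div, sub_zero]
  refine h.congr_fun fun m => ?_
  rw [Nat.factorial_succ]
  push_cast
  have := Nat.factorial_ne_zero m
  field_simp
  ring_nf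

theorem hasSum_fallFac_div_factorial (k : ℕ) :
    HasSum (fun m : ℕ => fallFac m k / m.factorial) (Real.exp 1) := by
  induction k with
  | zero =>
    rw [Real.exp_eq_exp_ℝ]
    simpa [fallFac] using NormedSpace.expSeries_div_hasSum_exp (1 : ℝ)
  | succ k ih =>
    simp only [fallFac_succ']
    exact hasSum_mul_shift_div_factorial (g := fun x => fallFac x k) ih

theorem hasSum_fallSum_div_factorial (f : Finset (Finset ℕ) → ℝ) (n : ℕ) :
    HasSum (fun m : ℕ => fallSum f n m / m.factorial)
      (Real.exp 1 * ∑ P ∈ partitions n, f P) := by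
  simp only [fallSum, Finset.sum_div, Finset.mul_sum]
  refine hasSum_sum fun P _ => ?_
  simp only [mul_div_assoc]
  rw [mul_comm]
  exact (hasSum_fallFac_div_factorial _).mul_left _

theorem hasSum_pow_div_factorial (n : ℕ) :
    HasSum (fun m : ℕ => (m : ℝ) ^ n / m.factorial) (Real.exp 1 * bell n) := by
  have h := hasSum_fallSum_div_factorial (fun _ => 1) n
  simpa [fallSum_one, bell] using h

theorem hasSum_mul_sub_one_pow_div_factorial (n : ℕ) :
    HasSum (fun m : ℕ => (m : ℝ) * (m - 1) ^ n / m.factorial) (Real.exp 1 * bell n) :=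
  hasSum_mul_shift_div_factorial (g := fun x => x ^ n) (hasSum_pow_div_factorial n)

theorem hasSum_mul_mul_sub_two_pow_div_factorial (n : ℕ) :
    HasSum (fun m : ℕ => (m : ℝ) * ((m - 1) * (m - 1 - 1) ^ n) / m.factorial)
      (Real.exp 1 * bell n) :=
  hasSum_mul_shift_div_factorial (g := fun x => x * (x - 1) ^ n)
    (hasSum_mul_sub_one_pow_div_factorial n)

theorem sum_crol (n : ℕ) :
    ∑ P ∈ partitions n, (crol P : ℝ) =
      (n / 2 + 9 / 4) * bell (n + 1) - 5 / 4 * bell (n + 2) + (n / 2 + 1 / 4) * bell n := by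
  have h := hasSum_fallSum_div_factorial (fun P => crol P) n
  have h' := (((((hasSum_pow_div_factorial (n + 1)).mul_left (n / 2 + 5 / 4 : ℝ)).sub
    ((hasSum_pow_div_factorial n).mul_left (n / 2 : ℝ))).sub
    ((hasSum_pow_div_factorial (n + 2)).mul_left (5 / 4 : ℝ))).add
    ((hasSum_mul_mul_sub_two_pow_div_factorial n).mul_left (1 / 4 : ℝ))).add
    ((hasSum_mul_sub_one_pow_div_factorial (n + 1)).add
      ((hasSum_mul_sub_one_pow_div_factorial n).mul_left (n : ℝ)))
  have heq := h.unique (h'.congr_fun fun m => by rw [fallSum_crol]; ring)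
  refine mul_left_cancel₀ (Real.exp_ne_zero 1) (heq.trans ?_)
  ring

theorem bell_pos (n : ℕ) : 0 < (bell n : ℝ) := by
  have h := hasSum_pow_div_factorial n
  have h1 := le_hasSum h 1 fun m _ => by positivity
  have h2 : (0 : ℝ) < Real.exp 1 * bell n := lt_of_lt_of_le (by norm_num) h1
  exact pos_of_mul_pos_right h2 (Real.exp_pos 1).le

theorem bell_le_bell_succ {n : ℕ} (hn : n ≠ 0) : (bell n : ℝ) ≤ bell (n + 1) := by
  refine le_of_mul_le_mul_left (hasSum_le (fun m => ?_) (hasSum_pow_div_factorial n)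
    (hasSum_pow_div_factorial (n + 1))) (Real.exp_pos 1)
  refine div_le_div_of_nonneg_right ?_ (Nat.cast_nonneg _)
  rcases Nat.eq_zero_or_pos m with rfl | hm
  · simp [hn]
  · exact pow_le_pow_right₀ (by exact_mod_cast hm) (Nat.le_succ n)

theorem pow_succ_add_mul_le_pow_succ {x a : ℝ} (hx : 0 ≤ x) (ha : 0 ≤ a) (n : ℕ) :
    a ^ (n + 1) + (n + 1) * a ^ n * (x - a) ≤ x ^ (n + 1) := by
  induction n with
  | zero => simp
  | succ n ih =>
    have h1 := mul_le_mul_of_nonneg_left ih hx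
    have h2 : 0 ≤ (n + 1) * a ^ n * (x - a) ^ 2 := by positivity
    push_cast
    calc _ = x * (a ^ (n + 1) + (n + 1) * a ^ n * (x - a)) - (n + 1) * a ^ n * (x - a) ^ 2 := by
          ring
      _ ≤ x * x ^ (n + 1) := by linarith
      _ = _ := by ring

theorem bell_succ_mul_pow_le {n : ℕ} (hn : n ≠ 0) :
    (bell (n + 1) : ℝ) * (1 - bell n / bell (n + 1)) ^ n ≤ bell n := by
  obtain ⟨n, rfl⟩ := Nat.exists_eq_succ_of_ne_zero hn
  rw [Nat.succ_eq_add_one] at *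
  have hB := bell_pos (n + 1 + 1)
  set v : ℝ := bell (n + 1) / bell (n + 1 + 1) with hv
  have hv1 : v ≤ 1 := div_le_one_of_le₀ (bell_le_bell_succ hn) hB.le
  have hvB : v * bell (n + 1 + 1) = bell (n + 1) := div_mul_cancel₀ _ hB.ne'
  have key := hasSum_le (fun m : ℕ => ?_)
    (((hasSum_pow_div_factorial (n + 1 + 1)).mul_left ((1 - v) ^ (n + 1))).sub
      (((hasSum_pow_div_factorial (n + 1)).sub
        ((hasSum_pow_div_factorial (n + 1 + 1)).mul_left v)).mul_left ((n + 1) * (1 - v) ^ n)))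
    (hasSum_mul_sub_one_pow_div_factorial (n + 1))
  · refine le_of_mul_le_mul_left ?_ (Real.exp_pos 1)
    refine le_trans (le_of_eq ?_) key
    rw [← hvB]
    ring
  · suffices h : (1 - v) ^ (n + 1) * (m : ℝ) ^ (n + 1 + 1) -
        (n + 1) * (1 - v) ^ n * ((m : ℝ) ^ (n + 1) - v * (m : ℝ) ^ (n + 1 + 1)) ≤
        m * (m - 1) ^ (n + 1) by
      refine le_trans (le_of_eq ?_)
        (div_le_div_of_nonneg_right h (Nat.cast_nonneg (α := ℝ) m.factorial))
      ring
    rcases Nat.eq_zero_or_pos m with rfl | hm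
    · simp
    · have hm' : (1 : ℝ) ≤ m := by exact_mod_cast hm
      have hm0 : (0 : ℝ) < m := by linarith
      have h := pow_succ_add_mul_le_pow_succ (x := 1 - 1 / m) (a := 1 - v)
        (by rw [sub_nonneg]; exact div_le_one_of_le₀ hm' hm0.le) (by linarith) n
      have h2 := mul_le_mul_of_nonneg_left h (pow_pos hm0 (n + 1 + 1)).le
      have e1 : (m : ℝ) * (m - 1) ^ (n + 1) = m ^ (n + 1 + 1) * (1 - 1 / m) ^ (n + 1) := by
        rw [pow_succ' (m : ℝ) (n + 1), mul_assoc, ← mul_pow]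
        congr 2
        field_simp
      rw [e1]
      refine le_trans (le_of_eq ?_) h2
      field_simp
      ring

theorem mul_pow_le_bell_succ {n : ℕ} (hn : n ≠ 0) :
    (bell n : ℝ) * (1 + bell n / bell (n + 1)) ^ n ≤ bell (n + 1) := by
  have hshift : HasSum (fun m : ℕ => ((m : ℝ) + 1) ^ n / m.factorial)
      (Real.exp 1 * bell (n + 1)) := by
    have h := (hasSum_nat_add_iff' 1).2 (hasSum_pow_div_factorial (n + 1))
    simp only [Finset.range_one, Finset.sum_singleton, Nat.cast_zero, ne_eq, Nat.succ_ne_zero,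
      not_false_eq_true, zero_pow, zero_div, sub_zero] at h
    refine h.congr_fun fun m => ?_
    rw [Nat.factorial_succ]
    push_cast
    have := Nat.factorial_ne_zero m
    field_simp
    ring
  obtain ⟨n, rfl⟩ := Nat.exists_eq_succ_of_ne_zero hn
  rw [Nat.succ_eq_add_one] at *
  have hB := bell_pos (n + 1 + 1)
  set v : ℝ := bell (n + 1) / bell (n + 1 + 1) with hv
  have hv0 : 0 ≤ v := by positivity
  have hvB : v * bell (n + 1 + 1) = bell (n + 1) := div_mul_cancel₀ _ hB.ne'
  have key := hasSum_le (fun m : ℕ => ?_)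
    (((hasSum_pow_div_factorial (n + 1)).mul_left ((1 + v) ^ (n + 1))).add
      (((hasSum_pow_div_factorial (n + 1)).sub
        ((hasSum_pow_div_factorial (n + 1 + 1)).mul_left v)).mul_left
        ((n + 1) * (1 + v) ^ n * v))) hshift
  · refine le_of_mul_le_mul_left ?_ (Real.exp_pos 1)
    refine le_trans (le_of_eq ?_) key
    rw [← hvB]
    ring
  · suffices h : (1 + v) ^ (n + 1) * (m : ℝ) ^ (n + 1) +
        (n + 1) * (1 + v) ^ n * v * ((m : ℝ) ^ (n + 1) - v * (m : ℝ) ^ (n + 1 + 1)) ≤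
        (m + 1) ^ (n + 1) by
      refine le_trans (le_of_eq ?_)
        (div_le_div_of_nonneg_right h (Nat.cast_nonneg (α := ℝ) m.factorial))
      ring
    rcases Nat.eq_zero_or_pos m with rfl | hm
    · simp
    · have hm0 : (0 : ℝ) < m := by exact_mod_cast hm
      have h := pow_succ_add_mul_le_pow_succ (x := 1 + 1 / m) (a := 1 + v)
        (by positivity) (by linarith) n
      have h3 : v - v ^ 2 * m ≤ 1 + 1 / m - (1 + v) := by
        have : 1 + 1 / (m : ℝ) - (1 + v) - (v - v ^ 2 * m) = (1 - v * m) ^ 2 / m := by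
          field_simp
          ring
        have : 0 ≤ (1 - v * m) ^ 2 / m := by positivity
        linarith
      have h4 : (1 + v) ^ (n + 1) + (n + 1) * (1 + v) ^ n * (v - v ^ 2 * m) ≤
          (1 + 1 / m) ^ (n + 1) := le_trans (by gcongr) h
      have h2 := mul_le_mul_of_nonneg_left h4 (pow_pos hm0 (n + 1)).le
      have e1 : ((m : ℝ) + 1) ^ (n + 1) = m ^ (n + 1) * (1 + 1 / m) ^ (n + 1) := by
        rw [← mul_pow]
        congr 1
        field_simp
      rw [e1]
      refine le_trans (le_of_eq ?_) h2
      ring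

/-- The ratio of consecutive Bell numbers. -/
noncomputable def bellRatio (n : ℕ) : ℝ := bell (n + 1) / bell n

theorem one_le_bellRatio {n : ℕ} (hn : n ≠ 0) : 1 ≤ bellRatio n :=
  (one_le_div (bell_pos n)).2 (bell_le_bell_succ hn)

theorem sub_one_mul_log_bellRatio_le {n : ℕ} (hn : n ≠ 0) :
    (bellRatio n - 1) * Real.log (bellRatio n) ≤ n := by
  have hB := bell_pos n
  have h := bell_succ_mul_pow_le hn
  have h1 := one_le_bellRatio hn
  have hinv : (bell n : ℝ) / bell (n + 1) = 1 / bellRatio n := by rw [bellRatio, one_div_div]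
  rw [hinv, ← div_le_one hB, mul_div_right_comm] at h
  change bellRatio n * _ ≤ 1 at h
  generalize bellRatio n = R at *
  rcases h1.eq_or_lt with rfl | h1
  · simp
  have hR : 0 < R := by linarith
  have hR' : 0 < R - 1 := by linarith
  have e : 1 - 1 / R = (R - 1) / R := by field_simp
  rw [e] at h
  have hlog := Real.log_nonpos (by positivity) h
  rw [Real.log_mul hR.ne' (by positivity), Real.log_pow] at hlog
  have h2 := Real.one_sub_inv_le_log_of_pos (div_pos hR' hR)
  have e2 : 1 - ((R - 1) / R)⁻¹ = -(1 / (R - 1)) := by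
    field_simp
    ring
  rw [e2] at h2
  have h3 : Real.log R ≤ n * (1 / (R - 1)) := by
    have := mul_le_mul_of_nonneg_left h2 (Nat.cast_nonneg (α := ℝ) n)
    linarith
  calc (R - 1) * Real.log R ≤ (R - 1) * (n * (1 / (R - 1))) := by gcongr
    _ = n := by field_simp

theorem le_add_one_mul_log_bellRatio {n : ℕ} (hn : n ≠ 0) :
    n ≤ (bellRatio n + 1) * Real.log (bellRatio n) := by
  have hB := bell_pos n
  have h := mul_pow_le_bell_succ hn
  have h1 := one_le_bellRatio hn
  have hinv : (bell n : ℝ) / bell (n + 1) = 1 / bellRatio n := by rw [bellRatio, one_div_div]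
  rw [hinv, mul_comm, ← le_div_iff₀ hB] at h
  change _ ≤ bellRatio n at h
  generalize bellRatio n = R at *
  have hR : 0 < R := by linarith
  have e : 1 + 1 / R = (R + 1) / R := by field_simp
  rw [e] at h
  have hlog := Real.log_le_log (by positivity) h
  rw [Real.log_pow] at hlog
  have h2 := Real.one_sub_inv_le_log_of_pos (x := (R + 1) / R) (by positivity)
  have e2 : 1 - ((R + 1) / R)⁻¹ = 1 / (R + 1) := by
    field_simp
    ring
  rw [e2] at h2
  have h3 : n * (1 / (R + 1)) ≤ Real.log R :=
    (mul_le_mul_of_nonneg_left h2 (Nat.cast_nonneg (α := ℝ) n)).trans hlog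
  calc (n : ℝ) = (R + 1) * (n * (1 / (R + 1))) := by field_simp
    _ ≤ (R + 1) * Real.log R := by gcongr

theorem crol_mean_eq (n : ℕ) :
    (∑ P ∈ partitions n, (crol P : ℝ)) / bell n =
      (n / 2 + 9 / 4) * bellRatio n - 5 / 4 * (bellRatio n * bellRatio (n + 1)) +
        (n / 2 + 1 / 4) := by
  have h0 := (bell_pos n).ne'
  have h1 := (bell_pos (n + 1)).ne'
  rw [sum_crol, bellRatio, bellRatio]
  field_simp

section Asymptotics

open Filter Topology

theorem tendsto_bellRatio_atTop : Tendsto bellRatio atTop atTop := by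
  have h : Tendsto (fun n : ℕ => Real.sqrt n - 1) atTop atTop :=
    tendsto_atTop_add_const_right _ _ (Real.tendsto_sqrt_atTop.comp tendsto_natCast_atTop_atTop)
  refine tendsto_atTop_mono' _ ?_ h
  filter_upwards [eventually_ne_atTop 0] with n hn
  have h1 := one_le_bellRatio hn
  have h2 := le_add_one_mul_log_bellRatio hn
  have h3 := Real.log_le_sub_one_of_pos (x := bellRatio n) (by linarith)
  rw [sub_le_iff_le_add]
  refine Real.sqrt_le_iff.2 ⟨by linarith, ?_⟩
  nlinarith

theorem tendsto_log_bellRatio_atTop :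
    Tendsto (fun n => Real.log (bellRatio n)) atTop atTop :=
  Real.tendsto_log_atTop.comp tendsto_bellRatio_atTop

theorem abs_bellRatio_mul_log_sub_le {n : ℕ} (hn : n ≠ 0) :
    |bellRatio n * Real.log (bellRatio n) - n| ≤ Real.log (bellRatio n) := by
  have h1 := sub_one_mul_log_bellRatio_le hn
  have h2 := le_add_one_mul_log_bellRatio hn
  rw [abs_le]
  constructor <;> linarith

theorem tendsto_div_bellRatio_mul_log :
    Tendsto (fun n : ℕ => n / (bellRatio n * Real.log (bellRatio n))) atTop (𝓝 1) := by
  have h : Tendsto (fun n => (bellRatio n)⁻¹) atTop (𝓝 0) :=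
    tendsto_inv_atTop_zero.comp tendsto_bellRatio_atTop
  rw [tendsto_iff_norm_sub_tendsto_zero]
  refine squeeze_zero' (Eventually.of_forall fun _ => norm_nonneg _) ?_ h
  filter_upwards [eventually_ne_atTop 0, tendsto_bellRatio_atTop.eventually_gt_atTop 0,
    tendsto_log_bellRatio_atTop.eventually_gt_atTop 0] with n hn hR hl
  have h1 := abs_bellRatio_mul_log_sub_le hn
  have e : n / (bellRatio n * Real.log (bellRatio n)) - 1 =
      (n - bellRatio n * Real.log (bellRatio n)) / (bellRatio n * Real.log (bellRatio n)) := by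
    field_simp
  rw [e, Real.norm_eq_abs, abs_div, abs_sub_comm, abs_of_pos (mul_pos hR hl),
    div_le_iff₀ (mul_pos hR hl)]
  refine h1.trans (le_of_eq ?_)
  field_simp

/-- `log n = log R + log log R + o(1)`, where `R` is the `n`-th ratio of Bell numbers. -/
theorem tendsto_log_sub_log_bellRatio_sub :
    Tendsto (fun n : ℕ => Real.log n - Real.log (bellRatio n) -
      Real.log (Real.log (bellRatio n))) atTop (𝓝 0) := by
  have h := (Real.continuousAt_log one_ne_zero).tendsto.comp tendsto_div_bellRatio_mul_log
  rw [Real.log_one] at h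
  refine h.congr' ?_
  filter_upwards [eventually_ne_atTop 0, tendsto_bellRatio_atTop.eventually_gt_atTop 0,
    tendsto_log_bellRatio_atTop.eventually_gt_atTop 0] with n hn hR hl
  have hn' : (n : ℝ) ≠ 0 := Nat.cast_ne_zero.2 hn
  simp only [Function.comp_apply]
  rw [Real.log_div hn' (mul_pos hR hl).ne', Real.log_mul hR.ne' hl.ne']
  ring

theorem tendsto_log_div_self_atTop : Tendsto (fun x : ℝ => Real.log x / x) atTop (𝓝 0) := by
  simpa using (Real.isLittleO_log_id_atTop).tendsto_div_nhds_zero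

theorem tendsto_log_div_log_bellRatio :
    Tendsto (fun n : ℕ => Real.log n / Real.log (bellRatio n)) atTop (𝓝 1) := by
  have hl := tendsto_log_bellRatio_atTop
  have h1 := (tendsto_log_sub_log_bellRatio_sub.mul (tendsto_inv_atTop_zero.comp hl)).add
    ((tendsto_log_div_self_atTop.comp hl).const_add 1)
  rw [mul_zero, zero_add, add_zero] at h1
  refine h1.congr' ?_
  filter_upwards [hl.eventually_gt_atTop 0] with n hl
  simp only [Function.comp_apply]
  field_simp
  ring

theorem tendsto_log_log_natCast_atTop :
    Tendsto (fun n : ℕ => Real.log (Real.log n)) atTop atTop :=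
  Real.tendsto_log_atTop.comp (Real.tendsto_log_atTop.comp tendsto_natCast_atTop_atTop)

theorem tendsto_log_log_div_log_log_bellRatio :
    Tendsto (fun n : ℕ => Real.log (Real.log n) / Real.log (Real.log (bellRatio n)))
      atTop (𝓝 1) := by
  have hl := tendsto_log_bellRatio_atTop
  have hll := Real.tendsto_log_atTop.comp hl
  have h := (Real.continuousAt_log one_ne_zero).tendsto.comp tendsto_log_div_log_bellRatio
  rw [Real.log_one] at h
  have h1 := (h.mul (tendsto_inv_atTop_zero.comp hll)).const_add 1
  rw [mul_zero, add_zero] at h1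
  refine h1.congr' ?_
  filter_upwards [hl.eventually_gt_atTop 0, hll.eventually_gt_atTop 0,
    (Real.tendsto_log_atTop.comp tendsto_natCast_atTop_atTop).eventually_gt_atTop 0] with
    n hl hll hn
  simp only [Function.comp_apply] at *
  rw [Real.log_div hn.ne' hl.ne']
  field_simp
  ring

theorem tendsto_log_sq_div_natCast :
    Tendsto (fun n : ℕ => Real.log n ^ 2 / n) atTop (𝓝 0) := by
  have h : Tendsto (fun x : ℝ => Real.log x ^ 2 / x) atTop (𝓝 0) := by
    simpa using (Real.isLittleO_pow_log_id_atTop (n := 2)).tendsto_div_nhds_zero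
  exact h.comp tendsto_natCast_atTop_atTop

/-- The ratio of consecutive Bell numbers is
`(n / log n) * (1 + (log log n / log n) * (1 + o(1)))`. -/
theorem tendsto_bellRatio_second_order :
    Tendsto (fun n : ℕ => (bellRatio n * Real.log n / n - 1) *
      (Real.log n / Real.log (Real.log n))) atTop (𝓝 1) := by
  have hl := tendsto_log_bellRatio_atTop
  have hll := Real.tendsto_log_atTop.comp hl
  have hn := Real.tendsto_log_atTop.comp (tendsto_natCast_atTop_atTop (R := ℝ))
  have hinv := tendsto_inv_atTop_zero.comp tendsto_log_log_natCast_atTop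
  have hmain : Tendsto (fun n : ℕ => (Real.log n - Real.log (bellRatio n)) /
      Real.log (bellRatio n) * (Real.log n / Real.log (Real.log n))) atTop (𝓝 1) := by
    have h := ((tendsto_log_log_div_log_log_bellRatio.inv₀ one_ne_zero).add
      (tendsto_log_sub_log_bellRatio_sub.mul hinv)).mul tendsto_log_div_log_bellRatio
    norm_num at h
    refine h.congr' ?_
    filter_upwards [hl.eventually_gt_atTop 0,
      tendsto_log_log_natCast_atTop.eventually_gt_atTop 0] with n hl hn
    field_simp
    ring
  have herr : Tendsto (fun n : ℕ => (bellRatio n * Real.log (bellRatio n) - n) / n *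
      (Real.log n / Real.log (bellRatio n)) * (Real.log n / Real.log (Real.log n)))
      atTop (𝓝 0) := by
    have h := tendsto_log_sq_div_natCast.mul hinv
    rw [mul_zero] at h
    refine squeeze_zero_norm' ?_ h
    filter_upwards [hl.eventually_gt_atTop 0, eventually_ne_atTop 0, hn.eventually_gt_atTop 0,
      tendsto_log_log_natCast_atTop.eventually_gt_atTop 0] with n hl hn0 hn hlln
    simp only [Function.comp_apply] at *
    have hn' : (0 : ℝ) < n := by positivity
    have h1 := abs_bellRatio_mul_log_sub_le hn0
    rw [Real.norm_eq_abs, abs_mul, abs_mul, abs_div, abs_of_pos hn',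
      abs_of_pos (div_pos hn hl), abs_of_pos (div_pos hn hlln)]
    calc _ ≤ Real.log (bellRatio n) / n * (Real.log n / Real.log (bellRatio n)) *
          (Real.log n / Real.log (Real.log n)) := by gcongr
      _ = _ := by field_simp
  have h := herr.add hmain
  rw [zero_add] at h
  refine h.congr' ?_
  filter_upwards [hl.eventually_gt_atTop 0, eventually_ne_atTop 0] with n hl hn0
  rw [← add_mul]
  congr 1
  have hn' : (n : ℝ) ≠ 0 := Nat.cast_ne_zero.2 hn0
  field_simp
  ring

theorem tendsto_bellRatio_mul_log_div :
    Tendsto (fun n : ℕ => bellRatio n * Real.log n / n) atTop (𝓝 1) := by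
  have hll := tendsto_log_log_natCast_atTop
  have hn := Real.tendsto_log_atTop.comp (tendsto_natCast_atTop_atTop (R := ℝ))
  have h := (tendsto_bellRatio_second_order.mul
    (tendsto_log_div_self_atTop.comp hn)).const_add 1
  norm_num at h
  refine h.congr' ?_
  filter_upwards [hll.eventually_gt_atTop 0, hn.eventually_gt_atTop 0] with n hll hn
  simp only [Function.comp_apply] at *
  field_simp
  ring

theorem tendsto_bellRatio_succ_mul_log_div :
    Tendsto (fun n : ℕ => bellRatio (n + 1) * (Real.log n / Real.log (Real.log n)) / n)
      atTop (𝓝 0) := by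
  have hll := tendsto_log_log_natCast_atTop
  have hn := Real.tendsto_log_atTop.comp (tendsto_natCast_atTop_atTop (R := ℝ))
  have h1 : Tendsto (fun n : ℕ => bellRatio (n + 1) * Real.log ((n + 1 : ℕ) : ℝ) /
      ((n + 1 : ℕ) : ℝ)) atTop (𝓝 1) := tendsto_bellRatio_mul_log_div.comp (tendsto_add_atTop_nat 1)
  have h2 := (tendsto_inv_atTop_zero.comp hll).const_mul 4
  rw [mul_zero] at h2
  refine squeeze_zero' ?_ ?_ h2
  · filter_upwards [hll.eventually_gt_atTop 0, hn.eventually_gt_atTop 0] with n hll hn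
    have := one_le_bellRatio (Nat.succ_ne_zero n)
    simp only [Function.comp_apply] at *
    positivity
  · filter_upwards [hll.eventually_gt_atTop 0, hn.eventually_gt_atTop 0, eventually_ge_atTop 1,
      h1.eventually_le_const (show (1 : ℝ) < 2 by norm_num)] with n hll hn hn1 h
    have hR := one_le_bellRatio (Nat.succ_ne_zero n)
    simp only [Function.comp_apply] at *
    have hn1' : (1 : ℝ) ≤ n := by exact_mod_cast hn1
    have hlog : Real.log n ≤ Real.log ((n + 1 : ℕ) : ℝ) :=
      Real.log_le_log (by linarith) (by push_cast; linarith)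
    rw [div_le_iff₀ (by positivity)] at h
    push_cast at h
    have h3 : bellRatio (n + 1) * Real.log n ≤ 4 * n := by
      calc bellRatio (n + 1) * Real.log n ≤ bellRatio (n + 1) * Real.log ((n + 1 : ℕ) : ℝ) := by
            gcongr
        _ ≤ 4 * n := by push_cast; linarith
    have e : bellRatio (n + 1) * (Real.log n / Real.log (Real.log n)) / n =
        bellRatio (n + 1) * Real.log n / (Real.log (Real.log n) * n) := by field_simp
    rw [e, div_le_iff₀ (by positivity)]
    refine h3.trans (le_of_eq ?_)
    field_simp

end Asymptotics

/-- asymptotics of the average number of linear crossings. -/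
theorem crol_mean_asymptotics :
    ∃ ε : ℕ → ℝ, Filter.Tendsto ε Filter.atTop (nhds 0) ∧
      ∀ᶠ n : ℕ in Filter.atTop,
        (∑ π ∈ partitions n, (crol π : ℝ)) / (bell n : ℝ)
          = ((n : ℝ)^2 / (2 * Real.log n)) *
              (1 + (Real.log (Real.log n) / Real.log n) * (1 + ε n)) := by
  have hll := tendsto_log_log_natCast_atTop
  have hn := Real.tendsto_log_atTop.comp (tendsto_natCast_atTop_atTop (R := ℝ))
  refine ⟨fun n => ((∑ π ∈ partitions n, (crol π : ℝ)) / (bell n : ℝ) * (2 * Real.log n / n ^ 2)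
    - 1) * (Real.log n / Real.log (Real.log n)) - 1, ?_, ?_⟩
  · have hs : Filter.Tendsto (fun n : ℕ => Real.log n ^ 2 / n * (Real.log (Real.log n))⁻¹)
        Filter.atTop (nhds 0) := by
      simpa using tendsto_log_sq_div_natCast.mul (tendsto_inv_atTop_zero.comp hll)
    have hs' : Filter.Tendsto (fun n : ℕ => Real.log n / n * (Real.log (Real.log n))⁻¹)
        Filter.atTop (nhds 0) := by
      simpa using (tendsto_log_div_self_atTop.comp (tendsto_natCast_atTop_atTop (R := ℝ))).mul
        (tendsto_inv_atTop_zero.comp hll)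
    have hnat : Filter.Tendsto (fun n : ℕ => (n : ℝ)⁻¹) Filter.atTop (nhds 0) :=
      tendsto_inv_atTop_zero.comp tendsto_natCast_atTop_atTop
    have h := ((((tendsto_bellRatio_second_order.add
      ((tendsto_bellRatio_mul_log_div.mul hs').const_mul (9 / 2))).sub
      ((tendsto_bellRatio_mul_log_div.mul tendsto_bellRatio_succ_mul_log_div).const_mul
        (5 / 2))).add (hs.mul ((hnat.const_mul (1 / 2)).const_add 1))).sub_const 1)
    norm_num only at h
    refine h.congr' ?_
    filter_upwards [hll.eventually_gt_atTop 0, hn.eventually_gt_atTop 0,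
      Filter.eventually_ne_atTop 0] with n hll hn hn0
    simp only [Function.comp_apply] at *
    have hn' : (n : ℝ) ≠ 0 := Nat.cast_ne_zero.2 hn0
    rw [crol_mean_eq]
    field_simp
    ring
  · filter_upwards [hll.eventually_gt_atTop 0, hn.eventually_gt_atTop 0,
      Filter.eventually_ne_atTop 0] with n hll hn hn0
    simp only [Function.comp_apply] at *
    have hn' : (n : ℝ) ≠ 0 := Nat.cast_ne_zero.2 hn0
    field_simp
    ring
end
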